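/- arXiv:2602.22681 — 6 statements merged into one kernel-verified Lean document; each statement's English description precedes it below -/
import Mathlib

section
/- For all w ∈ U and all u, v, q ∈ ℝ^p the following hold with δ_{F_s} := 2δ + δ_F: |qᵀ∇F_s^†(w)[u]v| ≤ (δ_{F_s}/G)‖u‖_{F(w)}‖q‖_{F(w)^{-1}}‖v‖_{F(w)^{-1}} and |qᵀ∇F_f^†(w)[u]v| ≤ (δ_{F_s}/G)‖u‖_{F(w)}‖q‖_{F(w)^{-1}}‖v‖_{F(w)^{-1}}; moreover |qᵀ∇F_s(w)[u]v| ≤ (δ_{F_s}/G)‖u‖_{F(w)}‖q‖_{F(w)}‖v‖_{F(w)} and |qᵀ∇F_f(w)[u]v| ≤ (δ_{F_s}/G)‖u‖_{F(w)}‖q‖_{F(w)}‖v‖_{F(w)}. -/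
open Matrix Set Filter

/-- Entrywise directional derivative `∇A(w)[v]` of a matrix-valued map. -/
noncomputable def matDeriv {p : ℕ} (A : (Fin p → ℝ) → Matrix (Fin p) (Fin p) ℝ)
    (w v : Fin p → ℝ) : Matrix (Fin p) (Fin p) ℝ :=
  fun i j => fderiv ℝ (fun x => A x i j) w v

/-- Euclidean gradient `∇f(w)`. -/
noncomputable def gradVec {p : ℕ} (f : (Fin p → ℝ) → ℝ) (w : Fin p → ℝ) : Fin p → ℝ :=
  fun j => fderiv ℝ f w (Pi.single j 1)

/-- Euclidean Hessian `∇²f(w)`. -/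
noncomputable def hessMat {p : ℕ} (f : (Fin p → ℝ) → ℝ) (w : Fin p → ℝ) :
    Matrix (Fin p) (Fin p) ℝ :=
  fun i j => fderiv ℝ (fun x => fderiv ℝ f x (Pi.single j 1)) w (Pi.single i 1)

/-- `‖v‖_M = √(vᵀ M v)`. -/
noncomputable def mnorm {p : ℕ} (M : Matrix (Fin p) (Fin p) ℝ) (v : Fin p → ℝ) : ℝ :=
  Real.sqrt (v ⬝ᵥ M *ᵥ v)

section MatDeriv

variable {p : ℕ} {A B C : (Fin p → ℝ) → Matrix (Fin p) (Fin p) ℝ} {w : Fin p → ℝ}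

lemma differentiableAt_mul_apply
    (hA : ∀ i j, DifferentiableAt ℝ (fun x => A x i j) w)
    (hB : ∀ i j, DifferentiableAt ℝ (fun x => B x i j) w) (i j : Fin p) :
    DifferentiableAt ℝ (fun x => (A x * B x) i j) w := by
  simp only [Matrix.mul_apply]
  exact DifferentiableAt.fun_sum fun k _ => (hA i k).mul (hB k j)

lemma matDeriv_mul
    (hA : ∀ i j, DifferentiableAt ℝ (fun x => A x i j) w)
    (hB : ∀ i j, DifferentiableAt ℝ (fun x => B x i j) w) (u : Fin p → ℝ) :
    matDeriv (fun x => A x * B x) w u = matDeriv A w u * B w + A w * matDeriv B w u := by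
  ext i j
  simp only [matDeriv, Matrix.mul_apply, Matrix.add_apply]
  rw [fderiv_fun_sum fun k _ => (hA i k).fun_mul (hB k j), ← Finset.sum_add_distrib]
  simp only [_root_.sum_apply]
  refine Finset.sum_congr rfl fun k _ => ?_
  rw [fderiv_fun_mul (hA i k) (hB k j)]
  simp only [_root_.add_apply, _root_.smul_apply, smul_eq_mul]
  ring

lemma matDeriv_mul_mul
    (hA : ∀ i j, DifferentiableAt ℝ (fun x => A x i j) w)
    (hB : ∀ i j, DifferentiableAt ℝ (fun x => B x i j) w)
    (hC : ∀ i j, DifferentiableAt ℝ (fun x => C x i j) w) (u : Fin p → ℝ) :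
    matDeriv (fun x => A x * B x * C x) w u =
      matDeriv A w u * B w * C w + A w * matDeriv B w u * C w
        + A w * B w * matDeriv C w u := by
  rw [matDeriv_mul (differentiableAt_mul_apply hA hB) hC, matDeriv_mul hA hB, Matrix.add_mul]

lemma matDeriv_one_sub (u : Fin p → ℝ) :
    matDeriv (fun x => 1 - A x) w u = -matDeriv A w u := by
  ext i j
  simp [matDeriv, fderiv_const_sub]

lemma transpose_matDeriv (hA : ∀ᶠ x in nhds w, (A x)ᵀ = A x) (u : Fin p → ℝ) :
    (matDeriv A w u)ᵀ = matDeriv A w u := by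
  ext i j
  have h : (fun x => A x j i) =ᶠ[nhds w] fun x => A x i j :=
    hA.mono fun x hx => congrFun (congrFun hx i) j
  simp only [matDeriv, Matrix.transpose_apply, h.fderiv_eq]

lemma differentiableAt_det (hA : ∀ i j, DifferentiableAt ℝ (fun x => A x i j) w) :
    DifferentiableAt ℝ (fun x => (A x).det) w := by
  simp only [Matrix.det_apply']
  exact DifferentiableAt.fun_sum fun σ _ =>
    (HasFDerivAt.finsetProd fun i _ => (hA (σ i) i).hasFDerivAt).differentiableAt.const_mul _

lemma differentiableAt_inv_apply (hA : ∀ i j, DifferentiableAt ℝ (fun x => A x i j) w)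
    (hdet : (A w).det ≠ 0) (i j : Fin p) :
    DifferentiableAt ℝ (fun x => (A x)⁻¹ i j) w := by
  simp only [Matrix.inv_def, Matrix.smul_apply, smul_eq_mul, Ring.inverse_eq_inv',
    Matrix.adjugate_apply]
  refine ((differentiableAt_det hA).inv hdet).mul (differentiableAt_det fun k l => ?_)
  by_cases hk : k = j
  · subst hk
    simp
  · simpa [Matrix.updateRow_ne hk] using hA k l

lemma matDeriv_inv (hA : ∀ i j, DifferentiableAt ℝ (fun x => A x i j) w)
    (hdet : ∀ x, IsUnit (A x).det) (u : Fin p → ℝ) :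
    matDeriv (fun x => (A x)⁻¹) w u = -((A w)⁻¹ * matDeriv A w u * (A w)⁻¹) := by
  have h := matDeriv_mul hA (differentiableAt_inv_apply hA (hdet w).ne_zero) u
  have h0 : matDeriv (fun x => A x * (A x)⁻¹) w u = 0 := by
    ext i j
    simp [matDeriv, Matrix.mul_nonsing_inv _ (hdet _)]
  rw [h0] at h
  have h1 := congrArg ((A w)⁻¹ * ·) h
  simp only [Matrix.mul_zero, Matrix.mul_add, Matrix.nonsing_inv_mul_cancel_left _ _ (hdet w)]
    at h1
  rw [Matrix.mul_assoc]
  exact (neg_eq_of_add_eq_zero_right h1.symm).symm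

end MatDeriv

section WeightedNorm

variable {p : ℕ} {M P P' M' : Matrix (Fin p) (Fin p) ℝ}

lemma mnorm_nonneg (M : Matrix (Fin p) (Fin p) ℝ) (v : Fin p → ℝ) : 0 ≤ mnorm M v :=
  Real.sqrt_nonneg _

lemma mnorm_neg (M : Matrix (Fin p) (Fin p) ℝ) (v : Fin p → ℝ) : mnorm M (-v) = mnorm M v := by
  simp [mnorm, Matrix.mulVec_neg]

lemma dotProduct_mulVec_of_transpose_eq (hM : Mᵀ = M) (x y : Fin p → ℝ) :
    x ⬝ᵥ M *ᵥ y = (M *ᵥ x) ⬝ᵥ y := by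
  rw [Matrix.dotProduct_mulVec, ← Matrix.mulVec_transpose, hM]

lemma Matrix.PosDef.transpose_eq_self (hM : M.PosDef) : Mᵀ = M := by
  simpa [Matrix.IsHermitian, Matrix.conjTranspose_eq_transpose_of_trivial] using hM.isHermitian

open scoped MatrixOrder Matrix.Norms.L2Operator in
lemma abs_dotProduct_mulVec_le (hM : M.PosSemidef) (x y : Fin p → ℝ) :
    |x ⬝ᵥ M *ᵥ y| ≤ mnorm M x * mnorm M y := by
  obtain ⟨B, rfl⟩ := CStarAlgebra.nonneg_iff_eq_star_mul_self.1 hM.nonneg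
  rw [Matrix.star_eq_conjTranspose]
  have key (a b : Fin p → ℝ) : a ⬝ᵥ (Bᴴ * B) *ᵥ b = (B *ᵥ a) ⬝ᵥ (B *ᵥ b) := by
    rw [← Matrix.mulVec_mulVec, Matrix.dotProduct_mulVec,
      Matrix.conjTranspose_eq_transpose_of_trivial, Matrix.vecMul_transpose]
  simp only [mnorm, key]
  rw [← Real.sqrt_mul (by simpa using dotProduct_self_star_nonneg (B *ᵥ x))]
  refine Real.abs_le_sqrt ?_
  simpa [dotProduct, sq] using
    Finset.sum_mul_sq_le_sq_mul_sq Finset.univ (B *ᵥ x) (B *ᵥ y)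

lemma mnorm_inv_mulVec (hM : M.PosDef) (v : Fin p → ℝ) : mnorm M⁻¹ (M *ᵥ v) = mnorm M v := by
  rw [mnorm, mnorm, Matrix.mulVec_mulVec,
    Matrix.nonsing_inv_mul _ ((Matrix.isUnit_iff_isUnit_det M).1 hM.isUnit), Matrix.one_mulVec,
    ← dotProduct_mulVec_of_transpose_eq hM.transpose_eq_self]

lemma exists_mulVec_eq (hM : M.PosDef) (y : Fin p → ℝ) : ∃ b, y = M *ᵥ b :=
  ⟨M⁻¹ *ᵥ y, by
    rw [Matrix.mulVec_mulVec,
      Matrix.mul_nonsing_inv _ ((Matrix.isUnit_iff_isUnit_det M).1 hM.isUnit),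
      Matrix.one_mulVec]⟩

lemma abs_dotProduct_le (hM : M.PosDef) (x y : Fin p → ℝ) :
    |x ⬝ᵥ y| ≤ mnorm M x * mnorm M⁻¹ y := by
  obtain ⟨b, rfl⟩ := exists_mulVec_eq hM y
  rw [mnorm_inv_mulVec hM]
  exact abs_dotProduct_mulVec_le hM.posSemidef x b

lemma mnorm_projection_le (hM : M.PosSemidef) (hP : P * P = P) (hPt : Pᵀ = P)
    (hPM : P * M = M * P) (v : Fin p → ℝ) : mnorm M (P *ᵥ v) ≤ mnorm M v := by
  refine Real.sqrt_le_sqrt ?_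
  have hQt : (1 - P)ᵀ = 1 - P := by simp [hPt]
  have hsum : M = P * (M * P) + (1 - P) * (M * (1 - P)) := by
    have h : P * (M * P) = M * P := by rw [← hPM, ← Matrix.mul_assoc, hP]
    simp only [Matrix.mul_sub, Matrix.sub_mul, Matrix.one_mul, Matrix.mul_one, h, hPM]
    abel
  have hnonneg := hM.dotProduct_mulVec_nonneg ((1 - P) *ᵥ v)
  have hsplit : v ⬝ᵥ M *ᵥ v =
      (P *ᵥ v) ⬝ᵥ M *ᵥ (P *ᵥ v) + ((1 - P) *ᵥ v) ⬝ᵥ M *ᵥ ((1 - P) *ᵥ v) := by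
    conv_lhs => rw [hsum]
    rw [Matrix.add_mulVec, dotProduct_add, ← dotProduct_mulVec_of_transpose_eq hPt,
      ← dotProduct_mulVec_of_transpose_eq hQt]
    simp only [Matrix.mulVec_mulVec]
  simp only [star_trivial] at hnonneg
  linarith

variable {c d : ℝ}

/-- First-order perturbation bound for the compression `P M P` of a metric by a projection. -/
lemma abs_perturb_compression_le (hM : M.PosDef) (hP : P * P = P) (hPt : Pᵀ = P)
    (hPM : P * M = M * P) (hP't : P'ᵀ = P') (hc : 0 ≤ c) (hd : 0 ≤ d)
    (hP' : ∀ v, mnorm M (P' *ᵥ v) ≤ c * mnorm M v)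
    (hM' : ∀ v, mnorm M⁻¹ (M' *ᵥ v) ≤ d * mnorm M v) (q v : Fin p → ℝ) :
    |q ⬝ᵥ (P' * M * P + P * M' * P + P * M * P') *ᵥ v|
      ≤ (2 * c + d) * (mnorm M q * mnorm M v) := by
  have hle := mnorm_projection_le hM.posSemidef hP hPt hPM
  have hn := mnorm_nonneg M
  have h1 : |q ⬝ᵥ (P' * M * P) *ᵥ v| ≤ (c * mnorm M q) * mnorm M v := by
    rw [Matrix.mul_assoc, ← Matrix.mulVec_mulVec, dotProduct_mulVec_of_transpose_eq hP't,
      ← Matrix.mulVec_mulVec]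
    exact (abs_dotProduct_mulVec_le hM.posSemidef _ _).trans
      (mul_le_mul (hP' q) (hle v) (hn _) (mul_nonneg hc (hn _)))
  have h2 : |q ⬝ᵥ (P * M' * P) *ᵥ v| ≤ mnorm M q * (d * mnorm M v) := by
    rw [Matrix.mul_assoc, ← Matrix.mulVec_mulVec, dotProduct_mulVec_of_transpose_eq hPt,
      ← Matrix.mulVec_mulVec]
    exact (abs_dotProduct_le hM _ _).trans
      (mul_le_mul (hle q) ((hM' _).trans (mul_le_mul_of_nonneg_left (hle v) hd))
        (mnorm_nonneg _ _) (hn _))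
  have h3 : |q ⬝ᵥ (P * M * P') *ᵥ v| ≤ mnorm M q * (c * mnorm M v) := by
    rw [Matrix.mul_assoc, ← Matrix.mulVec_mulVec, dotProduct_mulVec_of_transpose_eq hPt,
      ← Matrix.mulVec_mulVec]
    exact (abs_dotProduct_mulVec_le hM.posSemidef _ _).trans
      (mul_le_mul (hle q) (hP' v) (hn _) (hn _))
  simp only [Matrix.add_mulVec, dotProduct_add]
  refine ((abs_add_three _ _ _).trans (add_le_add (add_le_add h1 h2) h3)).trans_eq ?_
  ring

/-- First-order perturbation bound for the compression `P M⁻¹ P` of a dual metric by a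
projection. -/
lemma abs_perturb_compression_inv_le (hM : M.PosDef) (hP : P * P = P) (hPt : Pᵀ = P)
    (hPM : P * M = M * P) (hP't : P'ᵀ = P') (hc : 0 ≤ c) (hd : 0 ≤ d)
    (hP' : ∀ v, mnorm M (P' *ᵥ v) ≤ c * mnorm M v)
    (hM' : ∀ v, mnorm M⁻¹ (M' *ᵥ v) ≤ d * mnorm M v) (q v : Fin p → ℝ) :
    |q ⬝ᵥ (P' * M⁻¹ * P + P * -(M⁻¹ * M' * M⁻¹) * P + P * M⁻¹ * P') *ᵥ v|
      ≤ (2 * c + d) * (mnorm M⁻¹ q * mnorm M⁻¹ v) := by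
  obtain ⟨a, rfl⟩ := exists_mulVec_eq hM q
  obtain ⟨b, rfl⟩ := exists_mulVec_eq hM v
  have hdet := (Matrix.isUnit_iff_isUnit_det M).1 hM.isUnit
  have hMt := hM.transpose_eq_self
  have hle := mnorm_projection_le hM.posSemidef hP hPt hPM
  have hn := mnorm_nonneg M
  have hPr : M⁻¹ * (P * M) = P := by rw [hPM, Matrix.nonsing_inv_mul_cancel_left _ _ hdet]
  have hPl (X : Matrix (Fin p) (Fin p) ℝ) : M * (P * (M⁻¹ * X)) = P * X := by
    rw [← Matrix.mul_assoc, ← hPM, Matrix.mul_assoc, Matrix.mul_nonsing_inv_cancel_left _ _ hdet]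
  rw [mnorm_inv_mulVec hM, mnorm_inv_mulVec hM, ← dotProduct_mulVec_of_transpose_eq hMt,
    Matrix.mulVec_mulVec, Matrix.mulVec_mulVec]
  have hmat : M * (P' * M⁻¹ * P + P * -(M⁻¹ * M' * M⁻¹) * P + P * M⁻¹ * P') * M =
      M * (P' * P) + P * (-M' * P) + P * (P' * M) := by
    simp only [Matrix.mul_add, Matrix.add_mul, Matrix.mul_neg, Matrix.neg_mul, Matrix.mul_assoc,
      hPr, hPl]
  have h1 : |a ⬝ᵥ (M * (P' * P)) *ᵥ b| ≤ mnorm M a * (c * mnorm M b) := by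
    rw [← Matrix.mulVec_mulVec, ← Matrix.mulVec_mulVec]
    exact (abs_dotProduct_mulVec_le hM.posSemidef _ _).trans
      (mul_le_mul_of_nonneg_left ((hP' _).trans (mul_le_mul_of_nonneg_left (hle b) hc)) (hn _))
  have h2 : |a ⬝ᵥ (P * (-M' * P)) *ᵥ b| ≤ mnorm M a * (d * mnorm M b) := by
    rw [← Matrix.mulVec_mulVec, dotProduct_mulVec_of_transpose_eq hPt, ← Matrix.mulVec_mulVec,
      Matrix.neg_mulVec, dotProduct_neg, abs_neg]
    exact (abs_dotProduct_le hM _ _).trans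
      (mul_le_mul (hle a) ((hM' _).trans (mul_le_mul_of_nonneg_left (hle b) hd))
        (mnorm_nonneg _ _) (hn _))
  have h3 : |a ⬝ᵥ (P * (P' * M)) *ᵥ b| ≤ (c * mnorm M a) * mnorm M b := by
    rw [← Matrix.mulVec_mulVec, dotProduct_mulVec_of_transpose_eq hPt, ← Matrix.mulVec_mulVec,
      dotProduct_mulVec_of_transpose_eq hP't]
    exact (abs_dotProduct_mulVec_le hM.posSemidef _ _).trans
      (mul_le_mul_of_nonneg_right ((hP' _).trans (mul_le_mul_of_nonneg_left (hle a) hc)) (hn _))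
  rw [hmat]
  simp only [Matrix.add_mulVec, dotProduct_add]
  refine ((abs_add_three _ _ _).trans (add_le_add (add_le_add h1 h2) h3)).trans_eq ?_
  ring

end WeightedNorm

/-- Bounds on the derivatives of the compressions of a metric and of its inverse by a field of
orthogonal projections. -/
lemma matDeriv_compression_bounds {p : ℕ} {F Q : (Fin p → ℝ) → Matrix (Fin p) (Fin p) ℝ}
    {w : Fin p → ℝ} {κ κF : ℝ} (hκ : 0 ≤ κ) (hκF : 0 ≤ κF)
    (hF : ∀ i j, DifferentiableAt ℝ (fun x => F x i j) w) (hFpos : ∀ x, (F x).PosDef)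
    (hQ : ∀ i j, DifferentiableAt ℝ (fun x => Q x i j) w)
    (hQproj : Q w * Q w = Q w) (hQsymm : ∀ᶠ x in nhds w, (Q x)ᵀ = Q x)
    (hcomm : Q w * F w = F w * Q w)
    (hQb : ∀ u v, mnorm (F w) (matDeriv Q w u *ᵥ v) ≤ κ * (mnorm (F w) u * mnorm (F w) v))
    (hFb : ∀ u v, mnorm (F w)⁻¹ (matDeriv F w u *ᵥ v) ≤ κF * (mnorm (F w) u * mnorm (F w) v))
    (u v q : Fin p → ℝ) :
    |q ⬝ᵥ matDeriv (fun x => Q x * (F x)⁻¹ * Q x) w u *ᵥ v|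
        ≤ (2 * κ + κF) * (mnorm (F w) u * (mnorm (F w)⁻¹ q * mnorm (F w)⁻¹ v)) ∧
      |q ⬝ᵥ matDeriv (fun x => Q x * F x * Q x) w u *ᵥ v|
        ≤ (2 * κ + κF) * (mnorm (F w) u * (mnorm (F w) q * mnorm (F w) v)) := by
  have hdet (x) : IsUnit (F x).det := (Matrix.isUnit_iff_isUnit_det _).1 (hFpos x).isUnit
  have hinv := differentiableAt_inv_apply hF (hdet w).ne_zero
  have hn := mnorm_nonneg (F w) u
  have hQb' (v) : mnorm (F w) (matDeriv Q w u *ᵥ v) ≤ κ * mnorm (F w) u * mnorm (F w) v := by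
    rw [mul_assoc]; exact hQb u v
  have hFb' (v) : mnorm (F w)⁻¹ (matDeriv F w u *ᵥ v) ≤ κF * mnorm (F w) u * mnorm (F w) v := by
    rw [mul_assoc]; exact hFb u v
  rw [matDeriv_mul_mul hQ hinv hQ, matDeriv_mul_mul hQ hF hQ, matDeriv_inv hF hdet]
  constructor
  · refine (abs_perturb_compression_inv_le (hFpos w) hQproj hQsymm.self_of_nhds hcomm
      (transpose_matDeriv hQsymm u) (mul_nonneg hκ hn) (mul_nonneg hκF hn) hQb' hFb' q v).trans_eq
      ?_
    ring
  · refine (abs_perturb_compression_le (hFpos w) hQproj hQsymm.self_of_nhds hcomm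
      (transpose_matDeriv hQsymm u) (mul_nonneg hκ hn) (mul_nonneg hκF hn) hQb' hFb' q v).trans_eq
      ?_
    ring

/-- Bounds on the directional derivatives of `F_s = P_s F P_s`, `F_s† = P_s F⁻¹ P_s`,
`F_f = P_f F P_f`, `F_f† = P_f F⁻¹ P_f`, with `δ_{F_s} = 2δ + δ_F`. -/
theorem deriv_bounds_Fs_Ff
    {p : ℕ} (U : Set (Fin p → ℝ)) (hU : IsOpen U)
    (F Ps : (Fin p → ℝ) → Matrix (Fin p) (Fin p) ℝ)
    (f : (Fin p → ℝ) → ℝ)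
    (G δ δF : ℝ) (hG : 0 < G) (hδ : 0 ≤ δ) (hδF : 0 ≤ δF)
    (hFsmooth : ∀ i j, ContDiff ℝ (⊤ : ℕ∞) fun w => F w i j)
    (hFpos : ∀ w, (F w).PosDef)
    (hfan : AnalyticOnNhd ℝ f U)
    (hPssmooth : ∀ w ∈ U, ∀ i j, ContDiffAt ℝ (⊤ : ℕ∞) (fun x => Ps x i j) w)
    (hPsproj : ∀ w ∈ U, Ps w * Ps w = Ps w)
    (hPssymm : ∀ w ∈ U, (Ps w)ᵀ = Ps w)
    (hcomm : ∀ w ∈ U, Ps w * F w = F w * Ps w)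
    (hgradG : ∀ w ∈ U, mnorm ((F w)⁻¹) (gradVec f w) ≤ G)
    (hPsb : ∀ w ∈ U, ∀ u v : Fin p → ℝ,
      mnorm (F w) (matDeriv Ps w u *ᵥ v) ≤ δ / G * (mnorm (F w) u * mnorm (F w) v))
    (hFb : ∀ w ∈ U, ∀ u v : Fin p → ℝ,
      mnorm ((F w)⁻¹) (matDeriv F w u *ᵥ v) ≤ δF / G * (mnorm (F w) u * mnorm (F w) v))
    :
    ∀ w ∈ U, ∀ u v q : Fin p → ℝ,
      |q ⬝ᵥ matDeriv (fun x => Ps x * (F x)⁻¹ * Ps x) w u *ᵥ v|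
          ≤ (2 * δ + δF) / G *
            (mnorm (F w) u * (mnorm ((F w)⁻¹) q * mnorm ((F w)⁻¹) v)) ∧
      |q ⬝ᵥ matDeriv (fun x => (1 - Ps x) * (F x)⁻¹ * (1 - Ps x)) w u *ᵥ v|
          ≤ (2 * δ + δF) / G *
            (mnorm (F w) u * (mnorm ((F w)⁻¹) q * mnorm ((F w)⁻¹) v)) ∧
      |q ⬝ᵥ matDeriv (fun x => Ps x * F x * Ps x) w u *ᵥ v|
          ≤ (2 * δ + δF) / G * (mnorm (F w) u * (mnorm (F w) q * mnorm (F w) v)) ∧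
      |q ⬝ᵥ matDeriv (fun x => (1 - Ps x) * F x * (1 - Ps x)) w u *ᵥ v|
          ≤ (2 * δ + δF) / G * (mnorm (F w) u * (mnorm (F w) q * mnorm (F w) v)) := by
  intro w hw u v q
  have hF (i j) : DifferentiableAt ℝ (fun x => F x i j) w :=
    (hFsmooth i j).contDiffAt.differentiableAt (by simp)
  have hP (i j) : DifferentiableAt ℝ (fun x => Ps x i j) w :=
    (hPssmooth w hw i j).differentiableAt (by simp)
  have hsymm : ∀ᶠ x in nhds w, (Ps x)ᵀ = Ps x :=
    Filter.mem_of_superset (hU.mem_nhds hw) hPssymm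
  have hκ : 0 ≤ δ / G := by positivity
  have hκF : 0 ≤ δF / G := by positivity
  have hconst : (2 * δ + δF) / G = 2 * (δ / G) + δF / G := by ring
  rw [hconst]
  obtain ⟨h1, h2⟩ := matDeriv_compression_bounds hκ hκF hF hFpos hP (hPsproj w hw) hsymm
    (hcomm w hw) (hPsb w hw) (hFb w hw) u v q
  obtain ⟨h3, h4⟩ := matDeriv_compression_bounds (Q := fun x => 1 - Ps x) hκ hκF hF hFpos
    (fun i j => by simpa only [Matrix.sub_apply] using (hP i j).const_sub _)
    (by simp [Matrix.mul_sub, Matrix.sub_mul, hPsproj w hw])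
    (hsymm.mono fun x hx => by simp [hx])
    (by simp [Matrix.mul_sub, Matrix.sub_mul, hcomm w hw])
    (fun u v => by
      rw [matDeriv_one_sub, Matrix.neg_mulVec, mnorm_neg]
      exact hPsb w hw u v)
    (hFb w hw) u v q
  exact ⟨h1, h3, h2, h4⟩
end

section
/- If γ := λ_{H_F,s} − δ_{F_s}/2 > 0, then for every w ∈ U the quadratic-growth inequality (γλ_{F_s}/2)‖w − Φ(w)‖₂² ≤ f(w) − f(Φ(w)) holds, where ‖·‖₂ is the Euclidean norm. -/
open Matrix Set Filter

section EntrywiseDerivatives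

theorem HasDerivAt.dotProduct_of_entries {ι : Type*} [Fintype ι] {a b : ℝ → ι → ℝ}
    {a' b' : ι → ℝ} {t : ℝ} (ha : ∀ i, HasDerivAt (fun s => a s i) (a' i) t)
    (hb : ∀ i, HasDerivAt (fun s => b s i) (b' i) t) :
    HasDerivAt (fun s => a s ⬝ᵥ b s) (a' ⬝ᵥ b t + a t ⬝ᵥ b') t := by
  simp only [dotProduct, ← Finset.sum_add_distrib]
  exact HasDerivAt.fun_sum fun i _ => (ha i).mul (hb i)

theorem HasDerivAt.mulVec_apply_of_entries {m n : Type*} [Fintype n] {A : ℝ → Matrix m n ℝ}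
    {A' : Matrix m n ℝ} {b : ℝ → n → ℝ} {b' : n → ℝ} {t : ℝ}
    (hA : ∀ i j, HasDerivAt (fun s => A s i j) (A' i j) t)
    (hb : ∀ i, HasDerivAt (fun s => b s i) (b' i) t) (i : m) :
    HasDerivAt (fun s => (A s *ᵥ b s) i) ((A' *ᵥ b t + A t *ᵥ b') i) t :=
  HasDerivAt.dotProduct_of_entries (hA i) hb

open scoped Matrix.Norms.Operator in
theorem HasDerivAt.matrix_inv_apply_of_entries {n : Type*} [Fintype n] [DecidableEq n]
    {A : ℝ → Matrix n n ℝ} {A' : Matrix n n ℝ} {t : ℝ}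
    (hA : ∀ i j, HasDerivAt (fun s => A s i j) (A' i j) t) (hu : IsUnit (A t)) (i j : n) :
    HasDerivAt (fun s => (A s)⁻¹ i j) ((-((A t)⁻¹ * A' * (A t)⁻¹)) i j) t := by
  have hA' : HasDerivAt A A' t := hasDerivAt_pi.2 fun i => hasDerivAt_pi.2 fun j => hA i j
  obtain ⟨u, hu⟩ := hu
  have hinv : HasFDerivAt (Ring.inverse : Matrix n n ℝ → Matrix n n ℝ) _ (A t) :=
    hu ▸ hasFDerivAt_ringInverse (𝕜 := ℝ) u
  have h := hinv.comp_hasDerivAt t hA'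
  have hij := hasDerivAt_pi.1 (hasDerivAt_pi.1 h i) j
  simpa [Function.comp_def, ← Matrix.nonsing_inv_eq_ringInverse, ← hu] using hij

/-- Chain rule for the entries of a matrix-valued map along a curve. -/
theorem hasDerivAt_matDeriv_comp {p : ℕ} {A : (Fin p → ℝ) → Matrix (Fin p) (Fin p) ℝ}
    {x : ℝ → Fin p → ℝ} {v : Fin p → ℝ} {t : ℝ}
    (hA : ∀ i j, DifferentiableAt ℝ (fun w => A w i j) (x t)) (hx : HasDerivAt x v t)
    (i j : Fin p) : HasDerivAt (fun s => A (x s) i j) (matDeriv A (x t) v i j) t :=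
  (hA i j).hasFDerivAt.comp_hasDerivAt t hx

theorem fderiv_apply_eq_dotProduct {p : ℕ} (L : (Fin p → ℝ) →L[ℝ] ℝ) (v : Fin p → ℝ) :
    L v = v ⬝ᵥ fun i => L (Pi.single i 1) := by
  conv_lhs => rw [pi_eq_sum_univ' v]
  simp [dotProduct, map_sum]

theorem hasDerivAt_gradVec_comp {p : ℕ} {f : (Fin p → ℝ) → ℝ} {x : ℝ → Fin p → ℝ}
    {v : Fin p → ℝ} {t : ℝ} (hf : AnalyticAt ℝ f (x t)) (hx : HasDerivAt x v t) (j : Fin p) :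
    HasDerivAt (fun s => gradVec f (x s) j) ((v ᵥ* hessMat f (x t)) j) t := by
  have hd : DifferentiableAt ℝ (fun w => fderiv ℝ f w (Pi.single j 1)) (x t) :=
    hf.fderiv.differentiableAt.clm_apply (differentiableAt_const _)
  have h := hd.hasFDerivAt.comp_hasDerivAt t hx
  rwa [fderiv_apply_eq_dotProduct] at h

end EntrywiseDerivatives

section WeightedNorms

variable {p : ℕ}

theorem Matrix.PosDef.dotProduct_mulVec_nonneg_real {M : Matrix (Fin p) (Fin p) ℝ}
    (hM : M.PosDef) (v : Fin p → ℝ) : 0 ≤ v ⬝ᵥ M *ᵥ v := by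
  simpa using hM.posSemidef.dotProduct_mulVec_nonneg v

/-- Cauchy–Schwarz for the dual pair of norms given by `M⁻¹` and `M`. -/
theorem abs_dotProduct_le_mnorm_inv_mul_mnorm {M : Matrix (Fin p) (Fin p) ℝ}
    (hM : M.PosDef) (a b : Fin p → ℝ) : |a ⬝ᵥ b| ≤ mnorm M⁻¹ a * mnorm M b := by
  have hMM : M * M⁻¹ = 1 := Matrix.mul_nonsing_inv _ ((Matrix.isUnit_iff_isUnit_det _).1 hM.isUnit)
  have hMt : Mᵀ = M := by simpa using hM.isHermitian.eq
  have hcross : (M⁻¹ *ᵥ a) ⬝ᵥ M *ᵥ b = a ⬝ᵥ b := by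
    rw [← dotProduct_transpose_mulVec, hMt, Matrix.mulVec_mulVec, hMM, Matrix.one_mulVec,
      dotProduct_comm]
  have hpos := hM.dotProduct_mulVec_nonneg_real
  have hq : ∀ c : ℝ,
      0 ≤ (a ⬝ᵥ M⁻¹ *ᵥ a) * (c * c) + (-2 * (a ⬝ᵥ b)) * c + b ⬝ᵥ M *ᵥ b := by
    intro c
    have h := hpos (b - c • M⁻¹ *ᵥ a)
    have h₂ : M *ᵥ (M⁻¹ *ᵥ a) = a := by rw [Matrix.mulVec_mulVec, hMM, Matrix.one_mulVec]
    simp only [Matrix.mulVec_sub, Matrix.mulVec_smul, sub_dotProduct, dotProduct_sub,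
      smul_dotProduct, dotProduct_smul, hcross, h₂, smul_eq_mul] at h
    rw [dotProduct_comm b a, dotProduct_comm (M⁻¹ *ᵥ a) a] at h
    linarith
  have hd := discrim_le_zero hq
  rw [mnorm, mnorm, ← Real.sqrt_mul (hM.inv.dotProduct_mulVec_nonneg_real a)]
  refine Real.abs_le_sqrt ?_
  rw [discrim] at hd
  linarith

end WeightedNorms

section Dissipation

variable {p : ℕ}

/-- The pointwise inequality behind the exponential decay of the dissipation
`gᵀ P F⁻¹ P g` along the flow with velocity `-n`, where `n = P F⁻¹ P g`. -/
theorem dissipation_deriv_le {F P H F' P' : Matrix (Fin p) (Fin p) ℝ} {g n : Fin p → ℝ}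
    {G δ δF l : ℝ} (hG : 0 < G) (hδF : 0 ≤ δF) (hF : F.PosDef) (hPP : P * P = P)
    (hPt : Pᵀ = P) (hPt' : P'ᵀ = P') (hPF : P * F = F * P)
    (hn : n = (P * F⁻¹ * P) *ᵥ g) (hg : mnorm F⁻¹ g ≤ G)
    (hP' : mnorm F (P' *ᵥ n) ≤ δ / G * (mnorm F (-n) * mnorm F n))
    (hF' : mnorm F⁻¹ (F' *ᵥ n) ≤ δF / G * (mnorm F (-n) * mnorm F n))
    (hH : P *ᵥ n = n → l * (n ⬝ᵥ F *ᵥ n) ≤ n ⬝ᵥ H *ᵥ n) :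
    P *ᵥ n = n ∧ n ⬝ᵥ F *ᵥ n = g ⬝ᵥ n ∧
    (-n ᵥ* H) ⬝ᵥ (P *ᵥ F⁻¹ *ᵥ P *ᵥ g) + g ⬝ᵥ (P' *ᵥ F⁻¹ *ᵥ P *ᵥ g +
      P *ᵥ ((-(F⁻¹ * F' * F⁻¹)) *ᵥ P *ᵥ g +
        F⁻¹ *ᵥ (P' *ᵥ g + P *ᵥ (-n ᵥ* H)))) ≤
      -(2 * (l - (2 * δ + δF) / 2)) * (g ⬝ᵥ n) := by
  have hdet : IsUnit F.det := (Matrix.isUnit_iff_isUnit_det _).1 hF.isUnit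
  have hFK : F * F⁻¹ = 1 := Matrix.mul_nonsing_inv _ hdet
  have hKF : F⁻¹ * F = 1 := Matrix.nonsing_inv_mul _ hdet
  have hPK : P * F⁻¹ = F⁻¹ * P := by
    calc P * F⁻¹ = F⁻¹ * (F * P) * F⁻¹ := by
          rw [← Matrix.mul_assoc, hKF, Matrix.one_mul]
      _ = F⁻¹ * P * (F * F⁻¹) := by rw [← hPF]; simp only [Matrix.mul_assoc]
      _ = F⁻¹ * P := by rw [hFK, Matrix.mul_one]
  have hKt : (F⁻¹)ᵀ = F⁻¹ := by simpa using hF.inv.isHermitian.eq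
  have hPg : F⁻¹ *ᵥ P *ᵥ g = n := by
    rw [hn, hPK, Matrix.mul_assoc, hPP, Matrix.mulVec_mulVec]
  have hPn : P *ᵥ n = n := by
    rw [hn, Matrix.mulVec_mulVec, ← Matrix.mul_assoc, ← Matrix.mul_assoc, hPP]
  have hFn : F *ᵥ n = P *ᵥ g := by
    rw [← hPg, Matrix.mulVec_mulVec, hFK, Matrix.one_mulVec]
  have swap : ∀ (A : Matrix (Fin p) (Fin p) ℝ) (x y : Fin p → ℝ), Aᵀ = A →
      x ⬝ᵥ A *ᵥ y = (A *ᵥ x) ⬝ᵥ y := by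
    intro A x y hA
    rw [← dotProduct_transpose_mulVec, hA, dotProduct_comm]
  have hnFn : n ⬝ᵥ F *ᵥ n = g ⬝ᵥ n := by
    rw [hFn, swap P n g hPt, hPn, dotProduct_comm]
  refine ⟨hPn, hnFn, ?_⟩
  have hgPK : ∀ y, g ⬝ᵥ P *ᵥ F⁻¹ *ᵥ y = n ⬝ᵥ y := by
    intro y
    rw [swap P _ _ hPt, swap F⁻¹ _ _ hKt, hPg]
  have hexp : (-n ᵥ* H) ⬝ᵥ (P *ᵥ F⁻¹ *ᵥ P *ᵥ g) + g ⬝ᵥ (P' *ᵥ F⁻¹ *ᵥ P *ᵥ g +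
      P *ᵥ ((-(F⁻¹ * F' * F⁻¹)) *ᵥ P *ᵥ g +
        F⁻¹ *ᵥ (P' *ᵥ g + P *ᵥ (-n ᵥ* H)))) =
      -2 * (n ⬝ᵥ H *ᵥ n) + 2 * (g ⬝ᵥ P' *ᵥ n) - n ⬝ᵥ F' *ᵥ n := by
    have e₁ : (-(F⁻¹ * F' * F⁻¹)) *ᵥ P *ᵥ g = -(F⁻¹ *ᵥ F' *ᵥ n) := by
      rw [Matrix.neg_mulVec, ← Matrix.mulVec_mulVec, hPg, ← Matrix.mulVec_mulVec]
    have e₂ : n ⬝ᵥ P' *ᵥ g = g ⬝ᵥ P' *ᵥ n := by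
      rw [swap P' _ _ hPt', dotProduct_comm]
    have e₃ : (n ᵥ* H) ⬝ᵥ n = n ⬝ᵥ H *ᵥ n := (Matrix.dotProduct_mulVec n H n).symm
    have e₄ : n ⬝ᵥ P *ᵥ (n ᵥ* H) = n ⬝ᵥ H *ᵥ n := by
      rw [swap P _ _ hPt, hPn, dotProduct_comm, e₃]
    rw [e₁, hPg, hPn]
    simp only [Matrix.mulVec_add, Matrix.mulVec_neg, Matrix.neg_vecMul, dotProduct_add,
      dotProduct_neg, neg_dotProduct, hgPK, e₂, e₃, e₄]
    ring
  rw [hexp]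
  have hh : 0 ≤ g ⬝ᵥ n := hnFn ▸ hF.dotProduct_mulVec_nonneg_real n
  have hr : mnorm F n = √(g ⬝ᵥ n) := by rw [mnorm, hnFn]
  have hrn : mnorm F (-n) = √(g ⬝ᵥ n) := by
    rw [← hr]; simp [mnorm, Matrix.mulVec_neg]
  rw [hrn, hr] at hP' hF'
  set r := √(g ⬝ᵥ n) with hrdef
  have hr0 : 0 ≤ r := Real.sqrt_nonneg _
  have hrr : r * r = g ⬝ᵥ n := Real.mul_self_sqrt hh
  have hrG : r ≤ G := by
    have h := (le_abs_self _).trans (abs_dotProduct_le_mnorm_inv_mul_mnorm hF g n)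
    rw [hr, ← hrr] at h
    rcases hr0.eq_or_lt with h0 | h0
    · rw [← h0]; exact hG.le
    · exact (le_of_mul_le_mul_right h h0).trans hg
  have b₁ : g ⬝ᵥ P' *ᵥ n ≤ δ * (g ⬝ᵥ n) := by
    calc g ⬝ᵥ P' *ᵥ n ≤ mnorm F⁻¹ g * mnorm F (P' *ᵥ n) :=
          (le_abs_self _).trans (abs_dotProduct_le_mnorm_inv_mul_mnorm hF _ _)
      _ ≤ G * (δ / G * (r * r)) :=
          mul_le_mul hg hP' (Real.sqrt_nonneg _) hG.le
      _ = δ * (g ⬝ᵥ n) := by rw [hrr]; field_simp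
  have b₂ : -(n ⬝ᵥ F' *ᵥ n) ≤ δF * (g ⬝ᵥ n) := by
    calc -(n ⬝ᵥ F' *ᵥ n) ≤ |(F' *ᵥ n) ⬝ᵥ n| := by
          rw [dotProduct_comm]; exact neg_le_abs _
      _ ≤ mnorm F⁻¹ (F' *ᵥ n) * mnorm F n := abs_dotProduct_le_mnorm_inv_mul_mnorm hF _ _
      _ ≤ δF / G * (r * r) * G := by
          rw [hr]; exact mul_le_mul hF' hrG hr0 (by positivity)
      _ = δF * (g ⬝ᵥ n) := by rw [hrr]; field_simp
  have b₃ := hH hPn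
  rw [hnFn] at b₃
  linarith

end Dissipation

section EnergyEstimates

theorem AntitoneOn.le_of_tendsto_atTop {E : ℝ → ℝ} {c : ℝ} (hE : AntitoneOn E (Ici 0))
    (hlim : Tendsto E atTop (nhds c)) {t : ℝ} (ht : 0 ≤ t) : c ≤ E t := by
  refine le_of_tendsto hlim ?_
  filter_upwards [eventually_ge_atTop t] with s hs
  exact hE ht (ht.trans hs) hs

theorem antitoneOn_Ici_of_hasDerivAt_nonpos {φ φ' : ℝ → ℝ}
    (hφ : ∀ t, 0 ≤ t → HasDerivAt φ (φ' t) t) (hφ' : ∀ t, 0 ≤ t → φ' t ≤ 0) :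
    AntitoneOn φ (Ici 0) := by
  refine antitoneOn_of_hasDerivWithinAt_nonpos (convex_Ici 0) (f' := φ')
    (fun t ht => (hφ t ht).continuousAt.continuousWithinAt) ?_ ?_
  · intro t ht
    exact (hφ t (interior_subset ht)).hasDerivWithinAt
  · exact fun t ht => hφ' t (interior_subset ht)

/-- Exponential decay of the dissipation `h` of `E` yields a Polyak–Łojasiewicz inequality. -/
theorem energy_le_of_dissipation_decay {E h h' : ℝ → ℝ} {γ : ℝ}
    (hE : ∀ t, 0 ≤ t → HasDerivAt E (-h t) t) (hh : ∀ t, 0 ≤ t → HasDerivAt h (h' t) t)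
    (hdecay : ∀ t, 0 ≤ t → h' t ≤ -(2 * γ) * h t) (hnn : ∀ t, 0 ≤ t → 0 ≤ h t)
    (hlim : Tendsto E atTop (nhds 0)) {t : ℝ} (ht : 0 ≤ t) : 2 * γ * E t ≤ h t := by
  have hanti : AntitoneOn (fun t => h t - 2 * γ * E t) (Ici 0) :=
    antitoneOn_Ici_of_hasDerivAt_nonpos
      (fun s hs => (hh s hs).sub ((hE s hs).const_mul (2 * γ)))
      (fun s hs => by linarith [hdecay s hs])
  have hlim' : Tendsto (fun s => -(2 * γ * E s)) atTop (nhds 0) := by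
    simpa using (hlim.const_mul (2 * γ)).neg
  have : (0 : ℝ) ≤ h t - 2 * γ * E t := by
    refine le_of_tendsto hlim' ?_
    filter_upwards [eventually_ge_atTop t] with s hs
    have h₁ : h s - 2 * γ * E s ≤ h t - 2 * γ * E t := hanti ht (ht.trans hs) hs
    linarith [hnn s (ht.trans hs)]
  linarith

/-- Under a Polyak–Łojasiewicz inequality, the total displacement of an observable `y` whose
speed is controlled by the dissipation is controlled by the initial energy. -/
theorem sq_displacement_le_energy {E h y y' : ℝ → ℝ} {γ l D y₀ : ℝ} (hγ : 0 < γ) (hl : 0 < l)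
    (hD : 0 ≤ D) (hE : ∀ t, 0 ≤ t → HasDerivAt E (-h t) t)
    (hE0 : ∀ t, 0 ≤ t → 0 ≤ E t) (hPL : ∀ t, 0 ≤ t → 2 * γ * E t ≤ h t)
    (hlim : Tendsto E atTop (nhds 0)) (hy : ∀ t, 0 ≤ t → HasDerivAt y (y' t) t)
    (hspeed : ∀ t, 0 ≤ t → l * y' t ^ 2 ≤ D * h t)
    (hylim : Tendsto y atTop (nhds y₀)) (hpos : 0 ≤ y₀ - y 0) :
    γ * l / 2 * (y₀ - y 0) ^ 2 ≤ D * E 0 := by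
  suffices hε : ∀ ε : ℝ, 0 < ε → γ * l / 2 * (y₀ - y 0) ^ 2 ≤ D * (E 0 + ε) by
    have hc : Tendsto (fun ε : ℝ => D * (E 0 + ε)) (nhdsWithin 0 (Ioi 0)) (nhds (D * (E 0 + 0))) :=
      ((continuous_const.mul (continuous_const.add continuous_id)).tendsto 0).mono_left
        nhdsWithin_le_nhds
    rw [add_zero] at hc
    refine ge_of_tendsto hc ?_
    filter_upwards [self_mem_nhdsWithin] with ε hε' using hε ε hε'
  intro ε hε
  set e : ℝ → ℝ := fun t => ε * Real.exp (-(2 * γ) * t) with he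
  have hepos : ∀ t, 0 < e t := fun t => by positivity
  have hederiv : ∀ t, HasDerivAt e (-(2 * γ) * e t) t := by
    intro t
    have := (((hasDerivAt_id t).const_mul (-(2 * γ))).exp).const_mul ε
    simp only [id] at this
    exact this.congr_deriv (by simp only [he]; ring)
  have helim : Tendsto e atTop (nhds 0) := by
    have h₁ : Tendsto (fun t : ℝ => -(2 * γ) * t) atTop atBot :=
      tendsto_id.const_mul_atTop_of_neg (by linarith)
    simpa [he] using (Real.tendsto_exp_atBot.comp h₁).const_mul ε
  have hanti : AntitoneOn (fun t => √D * √(E t + e t) + √(γ * l / 2) * y t) (Ici 0) := by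
    refine antitoneOn_Ici_of_hasDerivAt_nonpos
      (fun t ht => ((((hE t ht).add (hederiv t)).sqrt
        (add_pos_of_nonneg_of_pos (hE0 t ht) (hepos t)).ne').const_mul (√D)).add
          ((hy t ht).const_mul (√(γ * l / 2)))) ?_
    intro t ht
    have hpt : 0 < E t + e t := add_pos_of_nonneg_of_pos (hE0 t ht) (hepos t)
    set q := √(E t + e t) with hq
    have hq0 : 0 < q := Real.sqrt_pos.2 hpt
    have hqq : q ^ 2 = E t + e t := Real.sq_sqrt hpt.le
    set k := h t + 2 * γ * e t with hk
    have hkq : 2 * γ * q ^ 2 ≤ k := by rw [hqq, hk]; linarith [hPL t ht]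
    have hk0 : 0 < k := lt_of_lt_of_le (by positivity) hkq
    have hhk : h t ≤ k := by rw [hk]; nlinarith [hepos t]
    have key : √(γ * l / 2) * y' t * (2 * q) ≤ √D * k := by
      refine abs_le_of_sq_le_sq' ?_ (by positivity) |>.2
      have h₁ : (√(γ * l / 2) * y' t * (2 * q)) ^ 2 = 2 * γ * q ^ 2 * (l * y' t ^ 2) := by
        rw [mul_pow, mul_pow, Real.sq_sqrt (by positivity)]; ring
      rw [h₁, mul_pow, Real.sq_sqrt hD]
      calc 2 * γ * q ^ 2 * (l * y' t ^ 2) ≤ k * (D * k) :=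
            mul_le_mul hkq ((hspeed t ht).trans (mul_le_mul_of_nonneg_left hhk hD))
              (by positivity) hk0.le
        _ = D * k ^ 2 := by ring
    have h₂ : √(γ * l / 2) * y' t ≤ √D * k / (2 * q) := by
      rw [le_div_iff₀ (by positivity)]; exact key
    have h₃ : √D * ((-h t + -(2 * γ) * e t) / (2 * q)) = -(√D * k / (2 * q)) := by
      rw [hk]; ring
    change √D * ((-h t + -(2 * γ) * e t) / (2 * q)) + √(γ * l / 2) * y' t ≤ 0
    rw [h₃]; linarith
  have hφlim : Tendsto (fun t => √D * √(E t + e t) + √(γ * l / 2) * y t) atTop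
      (nhds (√(γ * l / 2) * y₀)) := by
    simpa using (((hlim.add helim).sqrt).const_mul (√D)).add (hylim.const_mul (√(γ * l / 2)))
  have h0 := hanti.le_of_tendsto_atTop hφlim le_rfl
  have he0 : e 0 = ε := by simp [he]
  rw [he0] at h0
  have h₁ : √(γ * l / 2) * (y₀ - y 0) ≤ √D * √(E 0 + ε) := by linarith
  have h₂ := pow_le_pow_left₀ (mul_nonneg (Real.sqrt_nonneg _) hpos) h₁ 2
  rwa [mul_pow, mul_pow, Real.sq_sqrt (by positivity), Real.sq_sqrt hD,
    Real.sq_sqrt (by linarith [hE0 0 le_rfl])] at h₂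

end EnergyEstimates

theorem matDeriv_transpose_of_symm {p : ℕ} {U : Set (Fin p → ℝ)} (hU : IsOpen U)
    {A : (Fin p → ℝ) → Matrix (Fin p) (Fin p) ℝ} (hA : ∀ w ∈ U, (A w)ᵀ = A w)
    {w : Fin p → ℝ} (hw : w ∈ U) (v : Fin p → ℝ) : (matDeriv A w v)ᵀ = matDeriv A w v := by
  ext i j
  have h : (fun x => A x j i) =ᶠ[nhds w] fun x => A x i j := by
    filter_upwards [hU.mem_nhds hw] with x hx
    exact congrFun (congrFun (hA x hx) i) j
  simp only [Matrix.transpose_apply, matDeriv, h.fderiv_eq]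

/-- Quadratic growth along the sharp directions: if `γ = λ_{H_F,s} − δ_{F_s}/2 > 0` then
`(γ λ_{F_s}/2)‖w − Φ(w)‖₂² ≤ f(w) − f(Φ(w))` on `U`, where `δ_{F_s} = 2δ + δ_F`. -/
theorem quadratic_growth_to_river
    {p : ℕ} (U : Set (Fin p → ℝ)) (hU : IsOpen U)
    (F Ps : (Fin p → ℝ) → Matrix (Fin p) (Fin p) ℝ)
    (f : (Fin p → ℝ) → ℝ)
    (G δ δF : ℝ) (hG : 0 < G) (hδ : 0 ≤ δ) (hδF : 0 ≤ δF)
    (hFsmooth : ∀ i j, ContDiff ℝ (⊤ : ℕ∞) fun w => F w i j)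
    (hFpos : ∀ w, (F w).PosDef)
    (hfan : AnalyticOnNhd ℝ f U)
    (hPssmooth : ∀ w ∈ U, ∀ i j, ContDiffAt ℝ (⊤ : ℕ∞) (fun x => Ps x i j) w)
    (hPsproj : ∀ w ∈ U, Ps w * Ps w = Ps w)
    (hPssymm : ∀ w ∈ U, (Ps w)ᵀ = Ps w)
    (hcomm : ∀ w ∈ U, Ps w * F w = F w * Ps w)
    (hgradG : ∀ w ∈ U, mnorm ((F w)⁻¹) (gradVec f w) ≤ G)
    (hPsb : ∀ w ∈ U, ∀ u v : Fin p → ℝ,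
      mnorm (F w) (matDeriv Ps w u *ᵥ v) ≤ δ / G * (mnorm (F w) u * mnorm (F w) v))
    (hFb : ∀ w ∈ U, ∀ u v : Fin p → ℝ,
      mnorm ((F w)⁻¹) (matDeriv F w u *ᵥ v) ≤ δF / G * (mnorm (F w) u * mnorm (F w) v))
    (lamFs : ℝ)
    (hFseig : ∀ w ∈ U, ∀ v : Fin p → ℝ, Ps w *ᵥ v = v → lamFs * (v ⬝ᵥ v) ≤ v ⬝ᵥ F w *ᵥ v)
    (lamHFs LHFs : ℝ) (hlamHFs : 0 < lamHFs)
    (hHFs : ∀ w ∈ U, ∀ v : Fin p → ℝ, Ps w *ᵥ v = v →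
      lamHFs * (v ⬝ᵥ F w *ᵥ v) ≤ v ⬝ᵥ hessMat f w *ᵥ v ∧
      v ⬝ᵥ hessMat f w *ᵥ v ≤ LHFs * (v ⬝ᵥ F w *ᵥ v))
    (ψ : ℝ → (Fin p → ℝ) → Fin p → ℝ)
    (hψ0 : ∀ w ∈ U, ψ 0 w = w)
    (hψU : ∀ w ∈ U, ∀ t : ℝ, 0 ≤ t → ψ t w ∈ U)
    (hψode : ∀ w ∈ U, ∀ t : ℝ, 0 ≤ t →
      HasDerivAt (fun s => ψ s w)
        (-((Ps (ψ t w) * (F (ψ t w))⁻¹ * Ps (ψ t w)) *ᵥ gradVec f (ψ t w))) t)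
    (Φ : (Fin p → ℝ) → Fin p → ℝ)
    (hΦlim : ∀ w ∈ U, Tendsto (fun t => ψ t w) atTop (nhds (Φ w)))
    (hΦU : ∀ w ∈ U, Φ w ∈ U)
    (hγ : 0 < lamHFs - (2 * δ + δF) / 2) :
    ∀ w ∈ U,
      (lamHFs - (2 * δ + δF) / 2) * lamFs / 2 * ((w - Φ w) ⬝ᵥ (w - Φ w))
        ≤ f w - f (Φ w) := by
  intro w hw
  set γ := lamHFs - (2 * δ + δF) / 2 with hγdef
  set x : ℝ → Fin p → ℝ := fun t => ψ t w with hxdef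
  have hx0 : x 0 = w := hψ0 w hw
  have hxU : ∀ t, 0 ≤ t → x t ∈ U := hψU w hw
  set g : ℝ → Fin p → ℝ := fun t => gradVec f (x t) with hgdef
  set n : ℝ → Fin p → ℝ := fun t => (Ps (x t) * (F (x t))⁻¹ * Ps (x t)) *ᵥ g t with hndef
  have hxd : ∀ t, 0 ≤ t → HasDerivAt x (-n t) t := hψode w hw
  have hPd : ∀ t, 0 ≤ t → ∀ i j,
      HasDerivAt (fun s => Ps (x s) i j) (matDeriv Ps (x t) (-n t) i j) t := fun t ht =>
    hasDerivAt_matDeriv_comp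
      (fun i j => (hPssmooth _ (hxU t ht) i j).differentiableAt (by simp)) (hxd t ht)
  have hFd : ∀ t, 0 ≤ t → ∀ i j,
      HasDerivAt (fun s => F (x s) i j) (matDeriv F (x t) (-n t) i j) t := fun t ht =>
    hasDerivAt_matDeriv_comp
      (fun i j => (hFsmooth i j).contDiffAt.differentiableAt (by simp)) (hxd t ht)
  have hgd : ∀ t, 0 ≤ t → ∀ i,
      HasDerivAt (fun s => g s i) ((-n t ᵥ* hessMat f (x t)) i) t := fun t ht =>
    hasDerivAt_gradVec_comp (hfan _ (hxU t ht)) (hxd t ht)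
  set h : ℝ → ℝ := fun t => g t ⬝ᵥ Ps (x t) *ᵥ (F (x t))⁻¹ *ᵥ Ps (x t) *ᵥ g t with hhdef
  have hhn : ∀ t, h t = g t ⬝ᵥ n t := fun t => by
    simp only [hhdef, hndef, Matrix.mulVec_mulVec, Matrix.mul_assoc]
  have hhd := fun t (ht : 0 ≤ t) =>
    HasDerivAt.dotProduct_of_entries (hgd t ht)
      (HasDerivAt.mulVec_apply_of_entries (hPd t ht)
        (HasDerivAt.mulVec_apply_of_entries
          (HasDerivAt.matrix_inv_apply_of_entries (hFd t ht) (hFpos _).isUnit)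
          (HasDerivAt.mulVec_apply_of_entries (hPd t ht) (hgd t ht))))
  have hkey := fun t (ht : 0 ≤ t) =>
    dissipation_deriv_le (F := F (x t)) (P := Ps (x t)) (H := hessMat f (x t))
      (F' := matDeriv F (x t) (-n t)) (P' := matDeriv Ps (x t) (-n t)) (g := g t) (n := n t)
      hG hδF (hFpos _) (hPsproj _ (hxU t ht)) (hPssymm _ (hxU t ht))
      (matDeriv_transpose_of_symm hU hPssymm (hxU t ht) _) (hcomm _ (hxU t ht)) rfl
      (hgradG _ (hxU t ht)) (hPsb _ (hxU t ht) _ _) (hFb _ (hxU t ht) _ _)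
      (fun hn => (hHFs _ (hxU t ht) _ hn).1)
  have hnn : ∀ t, 0 ≤ t → 0 ≤ h t := fun t ht => by
    rw [hhn, ← (hkey t ht).2.1]
    exact (hFpos _).dotProduct_mulVec_nonneg_real _
  have hEd : ∀ t, 0 ≤ t → HasDerivAt (fun s => f (x s) - f (Φ w)) (-h t) t := fun t ht => by
    have hc := ((hfan _ (hxU t ht)).differentiableAt.hasFDerivAt.comp_hasDerivAt t
      (hxd t ht)).sub_const (f (Φ w))
    refine hc.congr_deriv ?_
    rw [fderiv_apply_eq_dotProduct, neg_dotProduct, hhn, dotProduct_comm]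
    rfl
  have hElim : Tendsto (fun s => f (x s) - f (Φ w)) atTop (nhds 0) := by
    simpa using ((hfan _ (hΦU w hw)).continuousAt.tendsto.comp (hΦlim w hw)).sub_const (f (Φ w))
  have hE0 : ∀ t, 0 ≤ t → 0 ≤ f (x t) - f (Φ w) := fun t ht =>
    (antitoneOn_Ici_of_hasDerivAt_nonpos hEd
      (fun s hs => by linarith [hnn s hs])).le_of_tendsto_atTop hElim ht
  have hPL := fun t (ht : 0 ≤ t) =>
    energy_le_of_dissipation_decay hEd hhd
      (fun s hs => (hkey s hs).2.2.trans_eq (by rw [← hhn])) hnn hElim ht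
  have hw0 := hE0 0 le_rfl
  rw [hx0] at hw0
  set D := (w - Φ w) ⬝ᵥ (w - Φ w) with hDdef
  have hD : 0 ≤ D := dotProduct_star_self_nonneg (w - Φ w)
  rcases le_or_gt lamFs 0 with hl | hl
  · refine le_trans ?_ hw0
    exact mul_nonpos_of_nonpos_of_nonneg (by nlinarith) hD
  set v := Φ w - w with hvdef
  have hDv : D = v ⬝ᵥ v := by rw [hDdef, hvdef, ← neg_sub w, neg_dotProduct_neg]
  have hyd : ∀ t, 0 ≤ t → HasDerivAt (fun s => v ⬝ᵥ x s) (v ⬝ᵥ -n t) t := fun t ht => by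
    simpa using HasDerivAt.dotProduct_of_entries (a := fun _ => v) (a' := 0)
      (fun i => hasDerivAt_const t (v i)) (hasDerivAt_pi.1 (hxd t ht))
  have hylim : Tendsto (fun s => v ⬝ᵥ x s) atTop (nhds (v ⬝ᵥ Φ w)) :=
    ((continuous_const.dotProduct continuous_id).tendsto (Φ w)).comp (hΦlim w hw)
  have hspeed : ∀ t, 0 ≤ t → lamFs * (v ⬝ᵥ -n t) ^ 2 ≤ D * h t := fun t ht => by
    have hcs : (v ⬝ᵥ -n t) ^ 2 ≤ D * (n t ⬝ᵥ n t) := by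
      have := Finset.sum_mul_sq_le_sq_mul_sq Finset.univ v (-n t)
      simpa [dotProduct, hDv, sq] using this
    have hlam := hFseig _ (hxU t ht) _ (hkey t ht).1
    rw [(hkey t ht).2.1, ← hhn] at hlam
    calc lamFs * (v ⬝ᵥ -n t) ^ 2 ≤ lamFs * (D * (n t ⬝ᵥ n t)) :=
          mul_le_mul_of_nonneg_left hcs hl.le
      _ = D * (lamFs * (n t ⬝ᵥ n t)) := by ring
      _ ≤ D * h t := mul_le_mul_of_nonneg_left hlam hD
  have hyD : v ⬝ᵥ Φ w - v ⬝ᵥ x 0 = D := by rw [hx0, ← dotProduct_sub, hDv]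
  have hfin := sq_displacement_le_energy hγ hl hD hEd hE0 hPL hElim hyd hspeed hylim
    (by rw [hyD]; exact hD)
  rw [hyD, hx0] at hfin
  rcases hD.eq_or_lt with h0 | h0
  · rw [← h0, mul_zero]; exact hw0
  · refine le_of_mul_le_mul_left ?_ h0
    linarith
end

section
/- Let a, b : [0,∞) → [0,∞) with a continuously differentiable and b continuous, and let λ > 0 be a constant. If a'(t) ≤ −λa(t) + √(a(t))·√(b(t)) for all t ≥ 0, then for all t ≥ 0: √(a(t)) ≤ e^{−(λ/2)t}√(a(0)) + (1/2)∫₀ᵗ e^{−(λ/2)(t−s)}√(b(s)) ds. -/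
open Set

/-- If `u' ≤ √u g` on `[0,∞)`, then `√u` grows at most like `½ ∫ g`; no differentiability of `√u`
is needed. -/
theorem sqrt_le_sqrt_add_integral_of_deriv_le_sqrt_mul {u u' g : ℝ → ℝ} (hg : Continuous g)
    (hg0 : ∀ t, 0 ≤ g t)
    (hu : ∀ t, 0 ≤ t → HasDerivWithinAt u (u' t) (Ici 0) t)
    (hle : ∀ t, 0 ≤ t → u' t ≤ √(u t) * g t) {t : ℝ} (ht : 0 ≤ t) :
    √(u t) ≤ √(u 0) + 1 / 2 * ∫ s in (0 : ℝ)..t, g s := by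
  have hint : ∀ s, 0 ≤ s → 0 ≤ ∫ r in (0 : ℝ)..s, g r := fun s hs =>
    intervalIntegral.integral_nonneg hs fun r _ => hg0 r
  have key : ∀ ε, 0 < ε →
      √(u t) ≤ √(u 0) + 1 / 2 * (∫ s in (0 : ℝ)..t, g s) + ε * (1 + t) := by
    intro ε hε
    set G : ℝ → ℝ := fun s => √(u 0) + 1 / 2 * (∫ r in (0 : ℝ)..s, g r) + ε * (1 + s) with hGdef
    have hGpos : ∀ s, 0 ≤ s → 0 < G s := fun s hs => by
      have := hint s hs
      have := Real.sqrt_nonneg (u 0)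
      simp only [hGdef]
      positivity
    have hG : ∀ s, HasDerivAt G (1 / 2 * g s + ε) s := fun s => by
      have h₁ := ((hg.integral_hasStrictDerivAt 0 s).hasDerivAt.const_mul (1 / 2)).const_add
        (√(u 0))
      have h₂ := ((hasDerivAt_id s).const_add 1).const_mul ε
      simpa [hGdef] using h₁.fun_add h₂
    have hGsq : ∀ s, HasDerivAt (fun r => G r ^ 2) (2 * G s * (1 / 2 * g s + ε)) s := fun s => by
      simpa using (hG s).fun_pow 2
    have hbound : u t ≤ G t ^ 2 := by
      refine image_le_of_deriv_right_lt_deriv_boundary' (a := 0) (b := t) (f' := u')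
        (fun s hs => (hu s hs.1).continuousWithinAt.mono fun r hr => hr.1)
        (fun s hs => (hu s hs.1).mono (Ici_subset_Ici.2 hs.1)) ?_
        (fun s _ => (hGsq s).continuousAt.continuousWithinAt)
        (fun s _ => (hGsq s).hasDerivWithinAt) ?_ ⟨ht, le_rfl⟩
      · refine (Real.sqrt_le_left (hGpos 0 le_rfl).le).1 ?_
        simp [hGdef, hε.le]
      · intro s hs hus
        have hpos := hGpos s hs.1
        have h := hle s hs.1
        rw [hus, Real.sqrt_sq hpos.le] at h
        nlinarith [mul_pos hpos hε]
    exact (Real.sqrt_le_left (hGpos t ht).le).2 hbound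
  refine le_of_forall_pos_le_add fun δ hδ => ?_
  have h1t : 0 < 1 + t := by linarith
  simpa [div_mul_cancel₀ δ h1t.ne'] using key (δ / (1 + t)) (div_pos hδ h1t)

/-- Gronwall-type lemma with square-root regularization: if `a, b ≥ 0` on `[0,∞)`,
`a` is continuously differentiable there with derivative `a'`, `b` is continuous, and
`a'(t) ≤ −λ a(t) + √(a(t))√(b(t))` for all `t ≥ 0`, then
`√(a(t)) ≤ e^{−(λ/2)t}√(a(0)) + (1/2)∫₀ᵗ e^{−(λ/2)(t−s)}√(b(s)) ds`. -/
theorem sqrt_gronwall (a b a' : ℝ → ℝ) (lam : ℝ) (hlam : 0 < lam)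
    (ha0 : ∀ t : ℝ, 0 ≤ t → 0 ≤ a t)
    (hb0 : ∀ t : ℝ, 0 ≤ t → 0 ≤ b t)
    (hderiv : ∀ t : ℝ, 0 ≤ t → HasDerivWithinAt a (a' t) (Ici 0) t)
    (ha'cont : ContinuousOn a' (Ici 0))
    (hbcont : ContinuousOn b (Ici 0))
    (hineq : ∀ t : ℝ, 0 ≤ t → a' t ≤ -lam * a t + Real.sqrt (a t) * Real.sqrt (b t)) :
    ∀ t : ℝ, 0 ≤ t →
      Real.sqrt (a t)
        ≤ Real.exp (-(lam / 2) * t) * Real.sqrt (a 0)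
          + 1 / 2 * ∫ s in (0 : ℝ)..t, Real.exp (-(lam / 2) * (t - s)) * Real.sqrt (b s) := by
  intro t ht
  have hg : Continuous fun s => Real.exp (lam / 2 * s) * √(b (max 0 s)) := by
    have hb : Continuous fun s => b (max 0 s) :=
      hbcont.comp_continuous (by fun_prop) fun s => le_max_left 0 s
    exact (by fun_prop : Continuous fun s => Real.exp (lam / 2 * s)).mul hb.sqrt
  have hexp : ∀ s, Real.exp (lam * s) = Real.exp (lam / 2 * s) ^ 2 := fun s => by
    rw [← Real.exp_nat_mul]
    congr 1
    push_cast
    ring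
  have hsqrt : ∀ s, √(Real.exp (lam * s) * a s) = Real.exp (lam / 2 * s) * √(a s) := fun s => by
    rw [hexp, Real.sqrt_mul (by positivity), Real.sqrt_sq (Real.exp_pos _).le]
  have h := sqrt_le_sqrt_add_integral_of_deriv_le_sqrt_mul
    (u := fun s => Real.exp (lam * s) * a s)
    (u' := fun s => Real.exp (lam * s) * lam * a s + Real.exp (lam * s) * a' s) hg
    (fun s => by positivity)
    (fun s hs => by
      simpa using (((hasDerivAt_id s).const_mul lam).exp.hasDerivWithinAt).fun_mul (hderiv s hs))
    (fun s hs => by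
      rw [hsqrt, max_eq_right hs, hexp]
      nlinarith [mul_le_mul_of_nonneg_left (hineq s hs) (sq_nonneg (Real.exp (lam / 2 * s)))]) ht
  simp only [hsqrt, mul_zero, Real.exp_zero, one_mul] at h
  have hinv : Real.exp (-(lam / 2) * t) * Real.exp (lam / 2 * t) = 1 := by
    rw [← Real.exp_add]
    simp
  have hintegral : ∫ s in (0 : ℝ)..t, Real.exp (-(lam / 2) * (t - s)) * √(b s) =
      Real.exp (-(lam / 2) * t) *
        ∫ s in (0 : ℝ)..t, Real.exp (lam / 2 * s) * √(b (max 0 s)) := by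
    rw [← intervalIntegral.integral_const_mul]
    refine intervalIntegral.integral_congr fun s hs => ?_
    rw [uIcc_of_le ht] at hs
    simp only [max_eq_right hs.1]
    rw [← mul_assoc, ← Real.exp_add]
    ring_nf
  calc √(a t) = Real.exp (-(lam / 2) * t) * (Real.exp (lam / 2 * t) * √(a t)) := by
        rw [← mul_assoc, hinv, one_mul]
    _ ≤ _ := mul_le_mul_of_nonneg_left h (Real.exp_pos _).le
    _ = _ := by
        rw [hintegral]
        ring
end

section
/- Let α ∈ (0,1), β ≥ 0, η > 0 and λ < 0, and set T := 1 − α/2 + η|λ|(β+1)/2 and D := (1−α)(1 + ηβ|λ|). Then: (i) T² − D > 0 (the overdamped regime); (ii) the dominant characteristic root r₁ := T + √(T² − D) satisfies r₁ > 1; and (iii) regarding r₁ as a function of (β, η), its partial derivatives satisfy ∂r₁/∂β > 0 and ∂r₁/∂η > 0, i.e., increasing the Hessian-damping coefficient β or the step size η strictly increases the escape rate r₁ along the negative-curvature direction. -/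
/-- The larger root `T + √(T² - D)` of `r² - 2 T r + D` has positive derivative as soon as
`D' < 2 T' r` at this root. -/
theorem deriv_dominant_root_pos {T D : ℝ → ℝ} {T' D' x : ℝ}
    (hT : HasDerivAt T T' x) (hD : HasDerivAt D D' x) (hpos : 0 < T x ^ 2 - D x)
    (h : D' < 2 * T' * (T x + Real.sqrt (T x ^ 2 - D x))) :
    0 < deriv (fun y => T y + Real.sqrt (T y ^ 2 - D y)) x := by
  have hder : HasDerivAt (fun y => T y + Real.sqrt (T y ^ 2 - D y)) _ x :=
    hT.add (((hT.pow 2).sub hD).sqrt hpos.ne')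
  rw [hder.deriv]
  have hS : 0 < Real.sqrt (T x ^ 2 - D x) := Real.sqrt_pos.2 hpos
  simp only [Pi.sub_apply, Pi.pow_apply]
  refine (div_pos (sub_pos.2 h) (mul_pos two_pos hS)).trans_eq ?_
  field_simp
  push_cast
  ring

/-- Escape along negative-curvature (flat nonconvex) directions: for `λ < 0`, with
`T = 1 − α/2 + η|λ|(β+1)/2` and `D = (1−α)(1 + ηβ|λ|)`, one has the overdamped regime
`T² − D > 0`, the dominant root `r₁ = T + √(T² − D)` satisfies `r₁ > 1`, and `r₁` is
strictly increasing in both the Hessian-damping coefficient `β` and the step size `η`. -/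
theorem negative_curvature_escape_rate
    (α β η lam : ℝ) (hα : α ∈ Set.Ioo (0 : ℝ) 1) (hβ : 0 ≤ β)
    (hη : 0 < η) (hlam : lam < 0) :
    0 < (1 - α / 2 + η * |lam| * (β + 1) / 2) ^ 2 - (1 - α) * (1 + η * β * |lam|) ∧
    1 < (1 - α / 2 + η * |lam| * (β + 1) / 2)
        + Real.sqrt
            ((1 - α / 2 + η * |lam| * (β + 1) / 2) ^ 2 - (1 - α) * (1 + η * β * |lam|)) ∧
    0 < deriv (fun b : ℝ =>
          (1 - α / 2 + η * |lam| * (b + 1) / 2)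
            + Real.sqrt
                ((1 - α / 2 + η * |lam| * (b + 1) / 2) ^ 2
                  - (1 - α) * (1 + η * b * |lam|))) β ∧
    0 < deriv (fun e : ℝ =>
          (1 - α / 2 + e * |lam| * (β + 1) / 2)
            + Real.sqrt
                ((1 - α / 2 + e * |lam| * (β + 1) / 2) ^ 2
                  - (1 - α) * (1 + e * β * |lam|))) η := by
  obtain ⟨hα0, hα1⟩ := hα
  have hL : 0 < |lam| := abs_pos.2 hlam.ne
  generalize |lam| = L at hL ⊢
  have hx : 0 < η * L := mul_pos hη hL
  have hgap : 0 < η * L * (1 + α * β) := by positivity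
  have hdisc : (1 - α / 2 + η * L * (β + 1) / 2) ^ 2 - (1 - α) * (1 + η * β * L)
      = (1 - (1 - α / 2 + η * L * (β + 1) / 2)) ^ 2 + η * L * (1 + α * β) := by ring
  have hpos : 0 < (1 - α / 2 + η * L * (β + 1) / 2) ^ 2 - (1 - α) * (1 + η * β * L) := by
    rw [hdisc]; positivity
  have hroot : 1 < (1 - α / 2 + η * L * (β + 1) / 2)
      + Real.sqrt ((1 - α / 2 + η * L * (β + 1) / 2) ^ 2 - (1 - α) * (1 + η * β * L)) := by
    rw [← sub_lt_iff_lt_add']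
    exact Real.lt_sqrt_of_sq_lt (by rw [hdisc]; linarith)
  refine ⟨hpos, hroot, ?_, ?_⟩
  · refine deriv_dominant_root_pos (T := fun b => 1 - α / 2 + η * L * (b + 1) / 2)
      (D := fun b => (1 - α) * (1 + η * b * L)) (T' := η * L / 2) (D' := (1 - α) * (η * L))
      ?_ ?_ hpos ?_
    · simpa using
        ((((hasDerivAt_id β).add_const 1).const_mul (η * L)).div_const 2).const_add (1 - α / 2)
    · simpa using
        ((((hasDerivAt_id β).const_mul η).mul_const L).const_add 1).const_mul (1 - α)
    · have h := mul_lt_mul_of_pos_left hroot hx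
      have := mul_pos hα0 hx
      linarith
  · refine deriv_dominant_root_pos (T := fun e => 1 - α / 2 + e * L * (β + 1) / 2)
      (D := fun e => (1 - α) * (1 + e * β * L)) (T' := L * (β + 1) / 2)
      (D' := (1 - α) * (β * L)) ?_ ?_ hpos ?_
    · simpa using
        ((((hasDerivAt_id η).mul_const L).mul_const (β + 1)).div_const 2).const_add (1 - α / 2)
    · simpa using
        ((((hasDerivAt_id η).mul_const β).mul_const L).const_add 1).const_mul (1 - α)
    · have h := mul_lt_mul_of_pos_left hroot (show 0 < L * (β + 1) by positivity)
      have : 0 ≤ α * (β * L) := by positivity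
      linarith
end

section
/- Let α ∈ (0,1), β ≥ 0, η > 0 and λ > 0, and set T := 1 − (α + ηλ(β+1))/2 and D := (1−α)(1 − ηβλ). Assume ηλ(β+1) ≤ α (equivalently T ≥ 1 − α) and T² > D (the flat convex, overdamped regime). Then the dominant characteristic root r₁ := T + √(T² − D) satisfies 0 < r₁ < 1, and regarding r₁ as a function of (β, η), its partial derivatives satisfy ∂r₁/∂β < 0 and ∂r₁/∂η < 0; i.e., increasing the Hessian-damping coefficient β or the step size η strictly decreases the dominant root and hence accelerates convergence in that coordinate. -/
/-- The dominant root of the quadratic with half-trace `T` and determinant `D` has negative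
derivative as soon as `2 * T' * r < D'` holds at the dominant root `r`. -/
theorem deriv_dominantRoot_neg {T D : ℝ → ℝ} {T' D' x : ℝ}
    (hT : HasDerivAt T T' x) (hD : HasDerivAt D D' x) (hlt : D x < T x ^ 2)
    (hroot : 2 * T' * (T x + Real.sqrt (T x ^ 2 - D x)) < D') :
    deriv (fun y => T y + Real.sqrt (T y ^ 2 - D y)) x < 0 := by
  have hpos : 0 < T x ^ 2 - D x := sub_pos.mpr hlt
  have hS : 0 < Real.sqrt (T x ^ 2 - D x) := Real.sqrt_pos.mpr hpos
  have h : HasDerivAt (fun y => T y + Real.sqrt (T y ^ 2 - D y))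
      (T' + (2 * T x * T' - D') / (2 * Real.sqrt (T x ^ 2 - D x))) x := by
    have hsq : HasDerivAt (fun y => T y ^ 2 - D y) (2 * T x * T' - D') x := by
      simpa using (hT.fun_pow 2).fun_sub hD
    exact hT.fun_add (hsq.sqrt hpos.ne')
  rw [h.deriv]
  have heq : T' + (2 * T x * T' - D') / (2 * Real.sqrt (T x ^ 2 - D x))
      = (2 * T' * (T x + Real.sqrt (T x ^ 2 - D x)) - D')
        / (2 * Real.sqrt (T x ^ 2 - D x)) := by
    field_simp
    ring
  rw [heq]
  exact div_neg_of_neg_of_pos (sub_neg.mpr hroot) (by positivity)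

/-- A function equal to `p + q * y` everywhere has derivative `q`. -/
theorem hasDerivAt_of_eq_affine {f : ℝ → ℝ} {p q : ℝ} (hf : ∀ y, f y = p + q * y) (x : ℝ) :
    HasDerivAt f q x := by
  rw [funext hf]
  simpa using ((hasDerivAt_id x).const_mul q).const_add p

/-- Acceleration along flat convex directions: for `λ > 0`, with
`T = 1 − (α + ηλ(β+1))/2` and `D = (1−α)(1 − ηβλ)`, if `ηλ(β+1) ≤ α` (so `T ≥ 1 − α`)
and `T² > D` (overdamped regime), then the dominant root `r₁ = T + √(T² − D)` satisfies
`0 < r₁ < 1`, and `r₁` is strictly decreasing in both the Hessian-damping coefficient `β`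
and the step size `η`. -/
theorem flat_convex_convergence_rate
    (α β η lam : ℝ) (hα : α ∈ Set.Ioo (0 : ℝ) 1) (hβ : 0 ≤ β)
    (hη : 0 < η) (hlam : 0 < lam)
    (hcond : η * lam * (β + 1) ≤ α)
    (hover : ((1 - α) * (1 - η * β * lam))
        < (1 - (α + η * lam * (β + 1)) / 2) ^ 2) :
    (0 < (1 - (α + η * lam * (β + 1)) / 2)
        + Real.sqrt
            ((1 - (α + η * lam * (β + 1)) / 2) ^ 2 - (1 - α) * (1 - η * β * lam)) ∧
      (1 - (α + η * lam * (β + 1)) / 2)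
        + Real.sqrt
            ((1 - (α + η * lam * (β + 1)) / 2) ^ 2 - (1 - α) * (1 - η * β * lam)) < 1) ∧
    deriv (fun b : ℝ =>
        (1 - (α + η * lam * (b + 1)) / 2)
          + Real.sqrt
              ((1 - (α + η * lam * (b + 1)) / 2) ^ 2
                - (1 - α) * (1 - η * b * lam))) β < 0 ∧
    deriv (fun e : ℝ =>
        (1 - (α + e * lam * (β + 1)) / 2)
          + Real.sqrt
              ((1 - (α + e * lam * (β + 1)) / 2) ^ 2
                - (1 - α) * (1 - e * β * lam))) η < 0 := by
  obtain ⟨hα0, hα1⟩ := hα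
  have hS : 0 < Real.sqrt
      ((1 - (α + η * lam * (β + 1)) / 2) ^ 2 - (1 - α) * (1 - η * β * lam)) :=
    Real.sqrt_pos.mpr (sub_pos.mpr hover)
  have hηl : 0 < η * lam := mul_pos hη hlam
  have hr : 1 - α < (1 - (α + η * lam * (β + 1)) / 2) + Real.sqrt
      ((1 - (α + η * lam * (β + 1)) / 2) ^ 2 - (1 - α) * (1 - η * β * lam)) := by
    linarith
  refine ⟨⟨by linarith, ?_⟩, ?_, ?_⟩
  · rw [← lt_sub_iff_add_lt', Real.sqrt_lt' (by nlinarith [mul_nonneg hηl.le hβ])]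
    nlinarith [mul_nonneg (mul_nonneg hηl.le hβ) hα0.le]
  · refine deriv_dominantRoot_neg (T' := -(η * lam) / 2) (D' := -((1 - α) * (η * lam)))
      (T := fun b => 1 - (α + η * lam * (b + 1)) / 2)
      (D := fun b => (1 - α) * (1 - η * b * lam))
      (hasDerivAt_of_eq_affine (p := 1 - (α + η * lam) / 2) (fun b => by ring) β)
      (hasDerivAt_of_eq_affine (p := 1 - α) (fun b => by ring) β) hover ?_
    have := mul_lt_mul_of_pos_left hr hηl
    linarith
  · refine deriv_dominantRoot_neg (T' := -(lam * (β + 1)) / 2) (D' := -((1 - α) * (β * lam)))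
      (T := fun e => 1 - (α + e * lam * (β + 1)) / 2)
      (D := fun e => (1 - α) * (1 - e * β * lam))
      (hasDerivAt_of_eq_affine (p := 1 - α / 2) (fun e => by ring) η)
      (hasDerivAt_of_eq_affine (p := 1 - α) (fun e => by ring) η) hover ?_
    have h₁ := mul_lt_mul_of_pos_left hr (mul_pos hlam (add_pos_of_nonneg_of_pos hβ one_pos))
    have h₂ := mul_pos hlam (sub_pos.mpr hα1)
    linarith
end

section
/- Let f : ℝ^p → ℝ be three times continuously differentiable, and let w, m^fast, m^slow : I → ℝ^p be continuously differentiable functions on an interval I satisfying the AdEMAMix continuous-time system: (d/dt)m^fast_t = −α₁m^fast_t + α₁∇f(w_t), (d/dt)m^slow_t = −α₂m^slow_t + α₂∇f(w_t), and ẇ_t = −η(m^fast_t + κ m^slow_t), for constants η > 0, α₁, α₂, κ ≥ 0. Then w_t is three times differentiable and satisfies the third-order ODE: w⃛_t + (α₁ + α₂)ẅ_t + α₁α₂ẇ_t + η(α₁ + κα₂)∇²f(w_t)ẇ_t + ηα₁α₂(1 + κ)∇f(w_t) = 0. -/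
open Matrix

theorem fderiv_fderiv_apply {E F : Type*} [NormedAddCommGroup E] [NormedSpace ℝ E]
    [NormedAddCommGroup F] [NormedSpace ℝ F] {f : E → F} (hf : ContDiff ℝ 2 f) (x u v : E) :
    fderiv ℝ (fun y => fderiv ℝ f y u) x v = fderiv ℝ (fderiv ℝ f) x v u := by
  have h : DifferentiableAt ℝ (fderiv ℝ f) x :=
    (hf.fderiv_right (m := 1) (by norm_num)).differentiable one_ne_zero x
  rw [fderiv_clm_apply h (differentiableAt_const u)]
  simp

theorem hessMat_mulVec_apply {p : ℕ} {f : (Fin p → ℝ) → ℝ} (hf : ContDiff ℝ 2 f)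
    (x v : Fin p → ℝ) (i : Fin p) :
    (hessMat f x *ᵥ v) i = fderiv ℝ (fderiv ℝ f) x v (Pi.single i 1) := by
  have hsymm : IsSymmSndFDerivAt ℝ f x := hf.contDiffAt.isSymmSndFDerivAt (by simp)
  rw [hsymm.eq v (Pi.single i 1)]
  set B := fderiv ℝ (fderiv ℝ f) x (Pi.single i 1)
  have hB : B v = ∑ j, v j * B (Pi.single j 1) := by
    conv_lhs => rw [← Finset.univ_sum_single v, map_sum]
    refine Finset.sum_congr rfl fun j _ => ?_
    rw [← smul_eq_mul, ← map_smul, ← Pi.single_smul, smul_eq_mul, mul_one]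
  rw [hB, Matrix.mulVec, dotProduct]
  refine Finset.sum_congr rfl fun j _ => ?_
  rw [mul_comm, hessMat, fderiv_fderiv_apply hf]

theorem HasDerivAt.gradVec_comp {p : ℕ} {f : (Fin p → ℝ) → ℝ} (hf : ContDiff ℝ 2 f)
    {w : ℝ → Fin p → ℝ} {w' : Fin p → ℝ} {t : ℝ} (hw : HasDerivAt w w' t) :
    HasDerivAt (fun s => gradVec f (w s)) (hessMat f (w t) *ᵥ w') t := by
  rw [hasDerivAt_pi]
  intro i
  rw [hessMat_mulVec_apply hf]
  have h : DifferentiableAt ℝ (fderiv ℝ f) (w t) :=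
    (hf.fderiv_right (m := 1) (by norm_num)).differentiable one_ne_zero _
  have h' := (h.hasFDerivAt.comp_hasDerivAt t hw).clm_apply
    (hasDerivAt_const t (Pi.single i 1 : Fin p → ℝ))
  simpa [gradVec] using h'

/-- The AdEMAMix continuous-time system
`ṁ^fast = −α₁m^fast + α₁∇f(w)`, `ṁ^slow = −α₂m^slow + α₂∇f(w)`,
`ẇ = −η(m^fast + κ m^slow)` implies that `w` is three times differentiable and satisfies
the third-order ODE
`w⃛ + (α₁+α₂)ẅ + α₁α₂ẇ + η(α₁+κα₂)∇²f(w)ẇ + ηα₁α₂(1+κ)∇f(w) = 0` on `I`. -/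
theorem adEMAMix_third_order_ode {p : ℕ}
    (f : (Fin p → ℝ) → ℝ) (hf : ContDiff ℝ 3 f)
    (I : Set ℝ) (hI : IsOpen I)
    (η α₁ α₂ κ : ℝ) (hη : 0 < η) (hα₁ : 0 ≤ α₁) (hα₂ : 0 ≤ α₂) (hκ : 0 ≤ κ)
    (w mf ms : ℝ → Fin p → ℝ)
    (hmf : ∀ t ∈ I, HasDerivAt mf (-α₁ • mf t + α₁ • gradVec f (w t)) t)
    (hms : ∀ t ∈ I, HasDerivAt ms (-α₂ • ms t + α₂ • gradVec f (w t)) t)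
    (hw : ∀ t ∈ I, HasDerivAt w (-η • (mf t + κ • ms t)) t) :
    ∀ t ∈ I,
      DifferentiableAt ℝ (deriv w) t ∧
      DifferentiableAt ℝ (deriv (deriv w)) t ∧
      deriv (deriv (deriv w)) t + (α₁ + α₂) • deriv (deriv w) t
          + (α₁ * α₂) • deriv w t
          + (η * (α₁ + κ * α₂)) • (hessMat f (w t) *ᵥ deriv w t)
          + (η * α₁ * α₂ * (1 + κ)) • gradVec f (w t) = 0 := by
  have hf2 : ContDiff ℝ 2 f := hf.of_le (by norm_num)
  have hd1 : ∀ t ∈ I, deriv w t = -η • (mf t + κ • ms t) := fun t ht => (hw t ht).deriv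
  have hw2 : ∀ t ∈ I, HasDerivAt (deriv w)
      (-η • ((-α₁ • mf t + α₁ • gradVec f (w t))
        + κ • (-α₂ • ms t + α₂ • gradVec f (w t)))) t := fun t ht =>
    (((hmf t ht).add ((hms t ht).const_smul κ)).const_smul (-η)).congr_of_eventuallyEq
      (Filter.eventuallyEq_of_mem (hI.mem_nhds ht) hd1)
  have hw3 : ∀ t ∈ I, HasDerivAt (deriv (deriv w))
      (-η • ((-α₁ • (-α₁ • mf t + α₁ • gradVec f (w t)) + α₁ • (hessMat f (w t) *ᵥ deriv w t))
        + κ • (-α₂ • (-α₂ • ms t + α₂ • gradVec f (w t))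
          + α₂ • (hessMat f (w t) *ᵥ deriv w t)))) t := by
    intro t ht
    have hg : HasDerivAt (fun s => gradVec f (w s)) (hessMat f (w t) *ᵥ deriv w t) t :=
      (hw t ht).differentiableAt.hasDerivAt.gradVec_comp hf2
    exact (((((hmf t ht).const_smul (-α₁)).add (hg.const_smul α₁)).add
      ((((hms t ht).const_smul (-α₂)).add (hg.const_smul α₂)).const_smul κ)).const_smul
        (-η)).congr_of_eventuallyEq
      (Filter.eventuallyEq_of_mem (hI.mem_nhds ht) fun s hs => (hw2 s hs).deriv)
  intro t ht
  refine ⟨(hw2 t ht).differentiableAt, (hw3 t ht).differentiableAt, ?_⟩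
  rw [(hw3 t ht).deriv, (hw2 t ht).deriv]
  generalize hessMat f (w t) *ᵥ deriv w t = h
  rw [hd1 t ht]
  module
end
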